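/- Assume the partition graph of the composite partitions 𝒥_A and 𝒥_B is connected and all basic cell masses m_i are positive. Let π ∈ Π(μ,ν) be such that for every composite cell J ∈ 𝒥_A ∪ 𝒥_B there exist bounded measurable functions α_J: X_J→ℝ and β_J: Y→ℝ with π⌊(X_J×Y) = exp((α_J(x)+β_J(y)−c(x,y))/ε)·(μ_J⊗ν). Then there exist measurable functions α*: X→ℝ and β*: Y→ℝ with π = exp((α*(x)+β*(y)−c(x,y))/ε)·(μ⊗ν); in particular π is the unique minimizer of the global entropic optimal transport problem min_{σ∈Π(μ,ν)} ⟨c,σ⟩ + ε·KL(σ|μ⊗ν). -/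

import Mathlib

open MeasureTheory Filter Topology
open scoped ENNReal

noncomputable section

/-- `π` is a coupling (transport plan) between `μ` and `ν`. -/
def IsCoupling {X Y : Type*} [MeasurableSpace X] [MeasurableSpace Y]
    (μ : Measure X) (ν : Measure Y) (π : Measure (X × Y)) : Prop :=
  π.map Prod.fst = μ ∧ π.map Prod.snd = ν

/-- `φ(s) = s·log s − s + 1`; note `Real.log 0 = 0`, so `phiKL 0 = 1` as required. -/
def phiKL (s : ℝ) : ℝ := s * Real.log s - s + 1

/-- Kullback–Leibler divergence `KL(ρ|σ) = ∫ φ(dρ/dσ) dσ` if `ρ ≪ σ`, and `+∞` otherwise. -/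
def KL {Z : Type*} [MeasurableSpace Z] (ρ σ : Measure Z) : ℝ≥0∞ :=
  letI := Classical.propDecidable (ρ ≪ σ)
  if ρ ≪ σ then ∫⁻ z, ENNReal.ofReal (phiKL ((ρ.rnDeriv σ) z).toReal) ∂σ else ⊤

/-- The entropic optimal transport objective `⟨c,π⟩ + ε·KL(π|μ⊗ν)`, valued in `EReal`. -/
def EOT {X Y : Type*} [MeasurableSpace X] [MeasurableSpace Y]
    (c : X × Y → ℝ) (ε : ℝ) (μ : Measure X) (ν : Measure Y)
    (π : Measure (X × Y)) : EReal :=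
  ((∫ p, c p ∂π : ℝ) : EReal) + (ε : EReal) * ((KL π (μ.prod ν) : ℝ≥0∞) : EReal)

/-- The Gibbs density `exp((a(x) + b(y) − c(x,y))/ε)`. -/
def gibbsDensity {X Y : Type*} (a : X → ℝ) (b : Y → ℝ) (c : X × Y → ℝ) (ε : ℝ) (p : X × Y) : ℝ :=
  Real.exp ((a p.1 + b p.2 - c p) / ε)

theorem gibbsDensity_pos {X Y : Type*} (a : X → ℝ) (b : Y → ℝ) (c : X × Y → ℝ) (ε : ℝ)
    (p : X × Y) : 0 < gibbsDensity a b c ε p := Real.exp_pos _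

theorem mul_log_gibbsDensity {X Y : Type*} (a : X → ℝ) (b : Y → ℝ) (c : X × Y → ℝ) {ε : ℝ}
    (hε : 0 < ε) (p : X × Y) :
    ε * Real.log (gibbsDensity a b c ε p) = a p.1 + b p.2 - c p := by
  rw [gibbsDensity, Real.log_exp]
  field_simp

theorem measurable_gibbsDensity {X Y : Type*} [MeasurableSpace X] [MeasurableSpace Y]
    {a : X → ℝ} {b : Y → ℝ} {c : X × Y → ℝ} (ha : Measurable a) (hb : Measurable b)
    (hc : Measurable c) (ε : ℝ) : Measurable (gibbsDensity a b c ε) := by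
  unfold gibbsDensity
  fun_prop

/-- The tangent inequality for `phiKL` at a positive point, with its equality case. -/
theorem phiKL_tangent {s p : ℝ} (hs : 0 ≤ s) (hp : 0 < p) :
    phiKL p + Real.log p * (s - p) ≤ phiKL s ∧
      (phiKL s = phiKL p + Real.log p * (s - p) → s = p) := by
  unfold phiKL
  rcases hs.eq_or_lt with rfl | hs
  · simp only [zero_mul, zero_sub, sub_zero, zero_add]
    constructor
    · linarith
    · intro h
      linarith
  · have hps : 0 < p / s := div_pos hp hs
    have hlog : Real.log (p / s) = Real.log p - Real.log s := Real.log_div hp.ne' hs.ne'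
    have hmul : s * (p / s) = p := by field_simp
    constructor
    · have h := mul_le_mul_of_nonneg_left (Real.log_le_sub_one_of_pos hps) hs.le
      rw [hlog, mul_sub s (p / s), hmul] at h
      linarith
    · intro h
      by_contra hne
      have hne' : p / s ≠ 1 := fun h1 => hne (by rw [h1] at hmul; linarith)
      have h' := mul_lt_mul_of_pos_left (Real.log_lt_sub_one_of_pos hps hne') hs
      rw [hlog, mul_sub s (p / s), hmul] at h'
      linarith

theorem phiKL_nonneg {s : ℝ} (hs : 0 ≤ s) : 0 ≤ phiKL s := by
  have h := (phiKL_tangent hs one_pos).1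
  simpa [phiKL] using h

theorem measurable_phiKL : Measurable phiKL := by
  unfold phiKL
  fun_prop

theorem absolutelyContinuous_of_KL_ne_top {Z : Type*} [MeasurableSpace Z] {ρ σ : Measure Z}
    (h : KL ρ σ ≠ ⊤) : ρ ≪ σ := by
  by_contra hac
  exact h (by simp [KL, hac])

theorem integrable_phiKL_of_KL_ne_top {Z : Type*} [MeasurableSpace Z] {ρ σ : Measure Z}
    (h : KL ρ σ ≠ ⊤) : Integrable (fun z => phiKL (ρ.rnDeriv σ z).toReal) σ := by
  have hac := absolutelyContinuous_of_KL_ne_top h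
  have hm : Measurable (fun z => phiKL (ρ.rnDeriv σ z).toReal) :=
    measurable_phiKL.comp (Measure.measurable_rnDeriv ρ σ).ennreal_toReal
  refine (lintegral_ofReal_ne_top_iff_integrable hm.aestronglyMeasurable
    (ae_of_all _ fun z => phiKL_nonneg ENNReal.toReal_nonneg)).1 ?_
  simpa [KL, hac] using h

theorem KL_toReal_eq_integral {Z : Type*} [MeasurableSpace Z] {ρ σ : Measure Z}
    (h : KL ρ σ ≠ ⊤) : (KL ρ σ).toReal = ∫ z, phiKL (ρ.rnDeriv σ z).toReal ∂σ := by
  have hac := absolutelyContinuous_of_KL_ne_top h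
  rw [integral_eq_lintegral_of_nonneg_ae
    (ae_of_all _ fun z => phiKL_nonneg ENNReal.toReal_nonneg)
    (integrable_phiKL_of_KL_ne_top h).aestronglyMeasurable]
  simp [KL, hac]

theorem EOT_eq_top {X Y : Type*} [MeasurableSpace X] [MeasurableSpace Y]
    {c : X × Y → ℝ} {ε : ℝ} (hε : 0 < ε) {μ : Measure X} {ν : Measure Y}
    {σ : Measure (X × Y)} (h : KL σ (μ.prod ν) = ⊤) : EOT c ε μ ν σ = ⊤ := by
  rw [EOT, h, EReal.coe_ennreal_top, EReal.coe_mul_top_of_pos hε, EReal.coe_add_top]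

theorem EOT_eq_coe {X Y : Type*} [MeasurableSpace X] [MeasurableSpace Y]
    {c : X × Y → ℝ} {ε : ℝ} {μ : Measure X} {ν : Measure Y}
    {σ : Measure (X × Y)} (h : KL σ (μ.prod ν) ≠ ⊤) :
    EOT c ε μ ν σ = ((∫ p, c p ∂σ + ε * (KL σ (μ.prod ν)).toReal : ℝ) : EReal) := by
  rw [EOT, ← EReal.coe_ennreal_toReal h]
  push_cast
  rfl

theorem IsCoupling.isProbabilityMeasure {X Y : Type*} [MeasurableSpace X] [MeasurableSpace Y]
    {μ : Measure X} {ν : Measure Y} [IsProbabilityMeasure μ] {σ : Measure (X × Y)}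
    (h : IsCoupling μ ν σ) : IsProbabilityMeasure σ := by
  constructor
  have := measure_univ (μ := μ)
  rwa [← h.1, Measure.map_apply measurable_fst MeasurableSet.univ, Set.preimage_univ] at this

theorem integrable_of_measurable_of_abs_le {Z : Type*} [MeasurableSpace Z] (ρ : Measure Z)
    [IsFiniteMeasure ρ] {f : Z → ℝ} (hf : Measurable f) {M : ℝ} (hM : ∀ z, |f z| ≤ M) :
    Integrable f ρ :=
  Integrable.of_bound hf.aestronglyMeasurable M (ae_of_all _ hM)

/-- The integral of a split potential against a coupling depends only on the marginals. -/
theorem IsCoupling.integral_add {X Y : Type*} [MeasurableSpace X] [MeasurableSpace Y]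
    {μ : Measure X} {ν : Measure Y} [IsProbabilityMeasure μ] {σ : Measure (X × Y)}
    (h : IsCoupling μ ν σ) {a : X → ℝ} {b : Y → ℝ} (ha : Measurable a) (hb : Measurable b)
    {A B : ℝ} (hA : ∀ x, |a x| ≤ A) (hB : ∀ y, |b y| ≤ B) :
    ∫ p, (a p.1 + b p.2) ∂σ = ∫ x, a x ∂μ + ∫ y, b y ∂ν := by
  have := h.isProbabilityMeasure
  refine (MeasureTheory.integral_add
    (integrable_of_measurable_of_abs_le σ (ha.comp measurable_fst) fun z => hA z.1)
    (integrable_of_measurable_of_abs_le σ (hb.comp measurable_snd) fun z => hB z.2)).trans ?_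
  conv_rhs => rw [← h.1, ← h.2]
  rw [integral_map measurable_fst.aemeasurable ha.aestronglyMeasurable,
    integral_map measurable_snd.aemeasurable hb.aestronglyMeasurable]
  rfl

theorem KL_gibbs_ne_top {X Y : Type*} [MeasurableSpace X] [MeasurableSpace Y]
    {μ : Measure X} {ν : Measure Y} [IsProbabilityMeasure μ] [IsProbabilityMeasure ν]
    {c : X × Y → ℝ} (hc : Measurable c) {C : ℝ} (hC : ∀ p, |c p| ≤ C) {ε : ℝ} (hε : 0 < ε)
    {a : X → ℝ} {b : Y → ℝ} (ha : Measurable a) (hb : Measurable b)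
    {A B : ℝ} (hA : ∀ x, |a x| ≤ A) (hB : ∀ y, |b y| ≤ B) :
    KL ((μ.prod ν).withDensity fun p => ENNReal.ofReal (gibbsDensity a b c ε p)) (μ.prod ν)
      ≠ ⊤ := by
  have hgm := measurable_gibbsDensity ha hb hc ε
  have hac := withDensity_absolutelyContinuous (μ.prod ν)
    fun p => ENNReal.ofReal (gibbsDensity a b c ε p)
  have hrn := Measure.rnDeriv_withDensity (μ.prod ν) hgm.ennreal_ofReal
  rw [KL, if_pos hac]
  have hcongr : ∫⁻ z, ENNReal.ofReal (phiKL (((μ.prod ν).withDensity fun p =>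
      ENNReal.ofReal (gibbsDensity a b c ε p)).rnDeriv (μ.prod ν) z).toReal) ∂(μ.prod ν)
      = ∫⁻ z, ENNReal.ofReal (phiKL (gibbsDensity a b c ε z)) ∂(μ.prod ν) := by
    refine lintegral_congr_ae ?_
    filter_upwards [hrn] with z hz
    rw [hz, ENNReal.toReal_ofReal (gibbsDensity_pos a b c ε z).le]
  rw [hcongr]
  have hint : Integrable (fun z => phiKL (gibbsDensity a b c ε z)) (μ.prod ν) := by
    refine integrable_of_measurable_of_abs_le _ (measurable_phiKL.comp hgm)
      (M := Real.exp ((A + B + C) / ε) * ((A + B + C) / ε) + Real.exp ((A + B + C) / ε) + 1) ?_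
    intro z
    have hz : |(a z.1 + b z.2 - c z) / ε| ≤ (A + B + C) / ε := by
      rw [abs_div, abs_of_pos hε]
      gcongr
      have h1 := hA z.1
      have h2 := hB z.2
      have h3 := hC z
      rw [abs_le] at *
      constructor <;> linarith
    have hexp : Real.exp ((a z.1 + b z.2 - c z) / ε) ≤ Real.exp ((A + B + C) / ε) :=
      Real.exp_le_exp.2 ((le_abs_self _).trans hz)
    have hpos := Real.exp_pos ((a z.1 + b z.2 - c z) / ε)
    unfold phiKL gibbsDensity
    rw [Real.log_exp]
    calc _ ≤ |Real.exp ((a z.1 + b z.2 - c z) / ε) * ((a z.1 + b z.2 - c z) / ε)|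
          + |Real.exp ((a z.1 + b z.2 - c z) / ε)| + |(1 : ℝ)| :=
        (abs_add_le _ _).trans (add_le_add_left (abs_sub _ _) _)
      _ ≤ _ := by
        rw [abs_mul, abs_of_pos hpos, abs_one]
        gcongr
  exact (lintegral_ofReal_ne_top_iff_integrable hint.aestronglyMeasurable
    (ae_of_all _ fun z => phiKL_nonneg (gibbsDensity_pos a b c ε z).le)).2 hint

/-- A coupling of Gibbs form with bounded potentials has the least entropic transport cost among
couplings of finite entropy, and it is the only one attaining it. -/
theorem gibbs_coupling_optimal {X Y : Type*} [MeasurableSpace X] [MeasurableSpace Y]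
    {μ : Measure X} {ν : Measure Y} [IsProbabilityMeasure μ] [IsProbabilityMeasure ν]
    {c : X × Y → ℝ} (hc : Measurable c) {C : ℝ} (hC : ∀ p, |c p| ≤ C) {ε : ℝ} (hε : 0 < ε)
    {a : X → ℝ} {b : Y → ℝ} (ha : Measurable a) (hb : Measurable b)
    {A B : ℝ} (hA : ∀ x, |a x| ≤ A) (hB : ∀ y, |b y| ≤ B)
    {π σ : Measure (X × Y)} (hπ : IsCoupling μ ν π) (hσ : IsCoupling μ ν σ)
    (hform : π = (μ.prod ν).withDensity fun p => ENNReal.ofReal (gibbsDensity a b c ε p))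
    (hKL : KL σ (μ.prod ν) ≠ ⊤) :
    ∫ p, c p ∂π + ε * (KL π (μ.prod ν)).toReal ≤ ∫ p, c p ∂σ + ε * (KL σ (μ.prod ν)).toReal ∧
      (∫ p, c p ∂σ + ε * (KL σ (μ.prod ν)).toReal
        ≤ ∫ p, c p ∂π + ε * (KL π (μ.prod ν)).toReal → σ = π) := by
  have := hπ.isProbabilityMeasure
  have := hσ.isProbabilityMeasure
  have hKLπ : KL π (μ.prod ν) ≠ ⊤ := hform ▸ KL_gibbs_ne_top hc hC hε ha hb hA hB
  have hrn : ∀ᵐ z ∂(μ.prod ν), (π.rnDeriv (μ.prod ν) z).toReal = gibbsDensity a b c ε z := by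
    rw [hform]
    filter_upwards [Measure.rnDeriv_withDensity (μ.prod ν)
      (measurable_gibbsDensity ha hb hc ε).ennreal_ofReal] with z hz
    rw [hz, ENNReal.toReal_ofReal (gibbsDensity_pos a b c ε z).le]
  have hacπ := absolutelyContinuous_of_KL_ne_top hKLπ
  have hacσ := absolutelyContinuous_of_KL_ne_top hKL
  have hiπ := (integrable_phiKL_of_KL_ne_top hKLπ).const_mul ε
  have hiσ := (integrable_phiKL_of_KL_ne_top hKL).const_mul ε
  have habm : Measurable fun p : X × Y => a p.1 + b p.2 := by fun_prop
  have habB : ∀ p : X × Y, |a p.1 + b p.2| ≤ A + B := fun p =>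
    (abs_add_le _ _).trans (add_le_add (hA _) (hB _))
  have hcost : ∀ ρ : Measure (X × Y), IsProbabilityMeasure ρ → ρ ≪ μ.prod ν →
      ∀ f : X × Y → ℝ, Measurable f → (∃ M, ∀ z, |f z| ≤ M) →
      Integrable (fun z => (ρ.rnDeriv (μ.prod ν) z).toReal * f z) (μ.prod ν) ∧
        ∫ z, (ρ.rnDeriv (μ.prod ν) z).toReal * f z ∂(μ.prod ν) = ∫ z, f z ∂ρ := by
    rintro ρ _ hac f hf ⟨M, hM⟩
    exact ⟨(integrable_rnDeriv_smul_iff hac).2 (integrable_of_measurable_of_abs_le ρ hf hM),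
      integral_rnDeriv_smul hac⟩
  obtain ⟨hicπ, hecπ⟩ := hcost π inferInstance hacπ c hc ⟨C, hC⟩
  obtain ⟨hicσ, hecσ⟩ := hcost σ inferInstance hacσ c hc ⟨C, hC⟩
  obtain ⟨hiabπ, heabπ⟩ := hcost π inferInstance hacπ _ habm ⟨_, habB⟩
  obtain ⟨hiabσ, heabσ⟩ := hcost σ inferInstance hacσ _ habm ⟨_, habB⟩
  have hab : ∫ p, (a p.1 + b p.2) ∂σ = ∫ p, (a p.1 + b p.2) ∂π := by
    rw [hσ.integral_add ha hb hA hB, hπ.integral_add ha hb hA hB]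
  set s := fun z => (σ.rnDeriv (μ.prod ν) z).toReal
  set q := fun z => (π.rnDeriv (μ.prod ν) z).toReal
  let gap : X × Y → ℝ := fun z =>
    ((s z * c z + ε * phiKL (s z)) - (q z * c z + ε * phiKL (q z)))
      - (s z * (a z.1 + b z.2) - q z * (a z.1 + b z.2))
  have hgap : ∀ z, q z = gibbsDensity a b c ε z →
      gap z = ε * (phiKL (s z) - (phiKL (q z) + Real.log (q z) * (s z - q z))) := by
    intro z hz
    have hl := mul_log_gibbsDensity a b c hε z
    rw [← hz] at hl
    have hab' : a z.1 + b z.2 = ε * Real.log (q z) + c z := by linarith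
    simp only [gap, hab']
    ring
  have hgap_nonneg : 0 ≤ᵐ[μ.prod ν] gap := by
    filter_upwards [hrn] with z hz
    have hp : 0 < q z := by
      change q z = _ at hz
      rw [hz]
      exact gibbsDensity_pos a b c ε z
    rw [hgap z hz]
    exact mul_nonneg hε.le (sub_nonneg.2 (phiKL_tangent ENNReal.toReal_nonneg hp).1)
  have hgap_int : Integrable gap (μ.prod ν) :=
    ((hicσ.add hiσ).sub (hicπ.add hiπ)).sub (hiabσ.sub hiabπ)
  have hgap_eq : ∫ z, gap z ∂(μ.prod ν) =
      (∫ p, c p ∂σ + ε * (KL σ (μ.prod ν)).toReal)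
        - (∫ p, c p ∂π + ε * (KL π (μ.prod ν)).toReal) := by
    have hsplit : ∫ z, gap z ∂(μ.prod ν) =
        ((∫ z, s z * c z ∂(μ.prod ν) + ∫ z, ε * phiKL (s z) ∂(μ.prod ν))
          - (∫ z, q z * c z ∂(μ.prod ν) + ∫ z, ε * phiKL (q z) ∂(μ.prod ν)))
        - (∫ z, s z * (a z.1 + b z.2) ∂(μ.prod ν) - ∫ z, q z * (a z.1 + b z.2) ∂(μ.prod ν)) := by
      rw [← MeasureTheory.integral_add hicσ hiσ, ← MeasureTheory.integral_add hicπ hiπ,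
        ← integral_sub hiabσ hiabπ]
      exact (integral_sub ((hicσ.add hiσ).sub (hicπ.add hiπ)) (hiabσ.sub hiabπ)).trans
        (congrArg (· - _) (integral_sub (hicσ.add hiσ) (hicπ.add hiπ)))
    rw [hsplit, integral_const_mul, integral_const_mul, heabπ, heabσ, hecπ, hecσ, hab,
      KL_toReal_eq_integral hKL, KL_toReal_eq_integral hKLπ]
    ring
  have hnn := integral_nonneg_of_ae hgap_nonneg
  refine ⟨by linarith, fun hle => ?_⟩
  have hzero : gap =ᵐ[μ.prod ν] 0 :=
    (integral_eq_zero_iff_of_nonneg_ae hgap_nonneg hgap_int).1 (by linarith)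
  rw [← Measure.withDensity_rnDeriv_eq σ _ hacσ, hform]
  refine withDensity_congr_ae ?_
  filter_upwards [hrn, hzero, Measure.rnDeriv_lt_top σ (μ.prod ν)] with z hz hz0 hlt
  have hp : 0 < q z := by
    change q z = _ at hz
    rw [hz]
    exact gibbsDensity_pos a b c ε z
  rw [hgap z hz] at hz0
  have h0 := (mul_eq_zero.1 hz0).resolve_left hε.ne'
  have hsq : s z = q z := (phiKL_tangent ENNReal.toReal_nonneg hp).2 (by linarith)
  rw [← hz, ← ENNReal.ofReal_toReal hlt.ne]
  exact congrArg ENNReal.ofReal hsq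

/-- Two Gibbs forms of the same measure over a non-null set have second potentials that differ by
a constant almost everywhere. -/
theorem exists_const_of_gibbs_eq {X Y : Type*} [MeasurableSpace X] [MeasurableSpace Y]
    {μ : Measure X} {ν : Measure Y} [IsProbabilityMeasure μ] [IsProbabilityMeasure ν]
    {c : X × Y → ℝ} (hc : Measurable c) {ε : ℝ} (hε : 0 < ε)
    {a a' : X → ℝ} {b b' : Y → ℝ} (ha : Measurable a) (hb : Measurable b)
    (ha' : Measurable a') (hb' : Measurable b') {S : Set X} (hS : 0 < μ S)
    (h : ((μ.restrict S).prod ν).withDensity (fun p => ENNReal.ofReal (gibbsDensity a b c ε p))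
      = ((μ.restrict S).prod ν).withDensity
        (fun p => ENNReal.ofReal (gibbsDensity a' b' c ε p))) :
    ∃ k : ℝ, ∀ᵐ y ∂ν, b y = b' y + k := by
  have hae := (withDensity_eq_iff_of_sigmaFinite
    (measurable_gibbsDensity ha hb hc ε).ennreal_ofReal.aemeasurable
    (measurable_gibbsDensity ha' hb' hc ε).ennreal_ofReal.aemeasurable).1 h
  have hne : (ae (μ.restrict S)).NeBot := by
    rw [ae_neBot, Ne, Measure.restrict_eq_zero]
    exact hS.ne'
  obtain ⟨x, hx⟩ := (Measure.ae_ae_of_ae_prod hae).exists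
  refine ⟨a' x - a x, ?_⟩
  filter_upwards [hx] with y hy
  have h1 := (ENNReal.ofReal_eq_ofReal_iff (gibbsDensity_pos a b c ε (x, y)).le
    (gibbsDensity_pos a' b' c ε (x, y)).le).1 hy
  have h2 := mul_log_gibbsDensity a b c hε (x, y)
  rw [h1, mul_log_gibbsDensity a' b' c hε (x, y)] at h2
  simp only at h2
  linarith

/-- First potentials given on the cells of a partition up to null sets glue to a global one. -/
theorem exists_glued_potential {X Y I : Type*} [MeasurableSpace X] [MeasurableSpace Y] [Fintype I]
    {μ : Measure X} {ν : Measure Y} [IsProbabilityMeasure μ] [IsProbabilityMeasure ν]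
    {c : X × Y → ℝ} {ε : ℝ} {π : Measure (X × Y)} {P : I → Set X}
    (hP : ∀ i, MeasurableSet (P i)) (hcover : ⋃ i, P i = Set.univ)
    (hdisj : ∀ i j, i ≠ j → μ (P i ∩ P j) = 0) {a : I → X → ℝ} {b : Y → ℝ}
    (ha : ∀ i, Measurable (a i)) (hbd : ∀ i, ∃ A, ∀ x, |a i x| ≤ A)
    (hloc : ∀ i, π.restrict (P i ×ˢ Set.univ) = ((μ.restrict (P i)).prod ν).withDensity
      (fun p => ENNReal.ofReal (gibbsDensity (a i) b c ε p))) :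
    ∃ α : X → ℝ, Measurable α ∧ (∃ A, ∀ x, |α x| ≤ A) ∧
      π = (μ.prod ν).withDensity (fun p => ENNReal.ofReal (gibbsDensity α b c ε p)) := by
  classical
  choose A hA using hbd
  refine ⟨fun x => ∑ i, (P i).indicator (a i) x, ?_, ⟨∑ i, A i, fun x => ?_⟩, ?_⟩
  · exact Finset.measurable_sum _ fun i _ => (ha i).indicator (hP i)
  · refine (Finset.abs_sum_le_sum_abs _ _).trans (Finset.sum_le_sum fun i _ => ?_)
    by_cases hx : x ∈ P i
    · simpa [hx] using hA i x
    · simpa [hx] using (abs_nonneg _).trans (hA i x)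
  · have hcov : ⋃ i, P i ×ˢ (Set.univ : Set Y) = Set.univ := by
      rw [← Set.iUnion_prod_const, hcover, Set.univ_prod_univ]
    refine (Measure.ext_iff_of_iUnion_eq_univ hcov).2 fun i => ?_
    rw [hloc i, restrict_withDensity ((hP i).prod MeasurableSet.univ), ← Measure.prod_restrict,
      Measure.restrict_univ]
    refine withDensity_congr_ae ?_
    have hx : ∀ᵐ x ∂(μ.restrict (P i)), a i x = ∑ j, (P j).indicator (a j) x := by
      have hnull : ∀ᵐ x ∂μ, ∀ j, i ≠ j → x ∉ P i ∩ P j := by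
        rw [ae_all_iff]
        intro j
        by_cases hij : i = j
        · simp [hij]
        · filter_upwards [measure_eq_zero_iff_ae_notMem.1 (hdisj i j hij)] with x hx _ using hx
      rw [ae_restrict_iff' (hP i)]
      filter_upwards [hnull] with x hx hxi
      rw [Finset.sum_eq_single i]
      · rw [Set.indicator_of_mem hxi]
      · intro j _ hj
        exact Set.indicator_of_notMem (fun hxj => hx j hj.symm ⟨hxi, hxj⟩) _
      · simp
    filter_upwards [Measure.quasiMeasurePreserving_fst.ae hx] with p hp
    simp only [gibbsDensity, hp]

/-- if the partition graph of the composite partitions `𝒥_A`, `𝒥_B` is connected,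
basic cell masses are positive, and `π` is locally of entropic form on every composite cell,
then `π` is globally of entropic form and is the unique minimizer of the global entropic
optimal transport problem. -/
theorem local_optimality_implies_global_optimality
    {X Y : Type*} [MetricSpace X] [CompactSpace X] [MeasurableSpace X] [BorelSpace X]
    [MetricSpace Y] [CompactSpace Y] [MeasurableSpace Y] [BorelSpace Y]
    {I : Type*} [Fintype I] [DecidableEq I]
    (μ : Measure X) (ν : Measure Y) [IsProbabilityMeasure μ] [IsProbabilityMeasure ν]
    (c : X × Y → ℝ) (hc : Continuous c) (ε : ℝ) (hε : 0 < ε)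
    (π : Measure (X × Y)) (hπ : IsCoupling μ ν π)
    -- basic partition into closed cells with positive masses
    (Xpart : I → Set X) (hclosed : ∀ i, IsClosed (Xpart i))
    (hcover : ⋃ i, Xpart i = Set.univ)
    (hdisj : ∀ i j, i ≠ j → μ (Xpart i ∩ Xpart j) = 0)
    (hm : ∀ i, 0 < μ (Xpart i))
    -- composite partitions 𝒥_A and 𝒥_B of the index set I
    (JA JB : Finset (Finset I))
    (hJA : ∀ i : I, ∃! J : Finset I, J ∈ JA ∧ i ∈ J)
    (hJB : ∀ i : I, ∃! J : Finset I, J ∈ JB ∧ i ∈ J)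
    -- the partition graph (vertices 𝒥_A ∪ 𝒥_B, edges = nonempty intersection) is connected
    (hconn : ∀ J ∈ JA ∪ JB, ∀ J' ∈ JA ∪ JB,
      Relation.ReflTransGen
        (fun K K' : Finset I => K ∈ JA ∪ JB ∧ K' ∈ JA ∪ JB ∧ (K ∩ K').Nonempty) J J')
    -- local entropic form of π on every composite cell
    (hlocal : ∀ J ∈ JA ∪ JB, ∃ (αJ : X → ℝ) (βJ : Y → ℝ) (M : ℝ),
      Measurable αJ ∧ Measurable βJ ∧ (∀ x, |αJ x| ≤ M) ∧ (∀ y, |βJ y| ≤ M) ∧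
      π.restrict ((⋃ i ∈ J, Xpart i) ×ˢ Set.univ)
        = ((μ.restrict (⋃ i ∈ J, Xpart i)).prod ν).withDensity
            (fun p => ENNReal.ofReal (Real.exp ((αJ p.1 + βJ p.2 - c p) / ε)))) :
    (∃ (αstar : X → ℝ) (βstar : Y → ℝ), Measurable αstar ∧ Measurable βstar ∧
      π = (μ.prod ν).withDensity
        (fun p => ENNReal.ofReal (Real.exp ((αstar p.1 + βstar p.2 - c p) / ε)))) ∧
    (∀ σ : Measure (X × Y), IsCoupling μ ν σ → EOT c ε μ ν π ≤ EOT c ε μ ν σ) ∧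
    (∀ σ : Measure (X × Y), IsCoupling μ ν σ →
      (∀ τ : Measure (X × Y), IsCoupling μ ν τ → EOT c ε μ ν σ ≤ EOT c ε μ ν τ) → σ = π) := by
  have hcm : Measurable c := hc.measurable
  obtain ⟨C, hC⟩ : ∃ C, ∀ p, |c p| ≤ C := by
    obtain ⟨C, hC⟩ := isCompact_univ.exists_bound_of_continuousOn hc.continuousOn
    exact ⟨C, fun p => hC p (Set.mem_univ p)⟩
  have hPm : ∀ i, MeasurableSet (Xpart i) := fun i => (hclosed i).measurableSet
  choose! a b M ham hbm haM hbM hform using hlocal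
  have hcell : ∀ J ∈ JA ∪ JB, ∀ i ∈ J, π.restrict (Xpart i ×ˢ Set.univ) =
      ((μ.restrict (Xpart i)).prod ν).withDensity
        (fun p => ENNReal.ofReal (gibbsDensity (a J) (b J) c ε p)) := by
    intro J hJ i hi
    have hsub : Xpart i ⊆ ⋃ j ∈ J, Xpart j := Set.subset_biUnion_of_mem (u := Xpart) hi
    have h := congrArg (fun ρ : Measure (X × Y) => ρ.restrict (Xpart i ×ˢ Set.univ)) (hform J hJ)
    simp only at h
    rw [Measure.restrict_restrict_of_subset (Set.prod_mono hsub subset_rfl),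
      restrict_withDensity ((hPm i).prod MeasurableSet.univ), ← Measure.prod_restrict,
      Measure.restrict_restrict_of_subset hsub, Measure.restrict_univ] at h
    exact h
  have hconst : ∀ J ∈ JA ∪ JB, ∀ J' ∈ JA ∪ JB, ∃ k : ℝ, ∀ᵐ y ∂ν, b J' y = b J y + k := by
    intro J hJ J' hJ'
    induction hconn J hJ J' hJ' with
    | refl => exact ⟨0, ae_of_all _ fun y => by simp⟩
    | tail _ hstep ih =>
      obtain ⟨hK, hK', i, hi⟩ := hstep
      obtain ⟨k, hk⟩ := ih hK
      rw [Finset.mem_inter] at hi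
      obtain ⟨l, hl⟩ := exists_const_of_gibbs_eq hcm hε (ham _ hK') (hbm _ hK') (ham _ hK)
        (hbm _ hK) (hm i) ((hcell _ hK' i hi.2).symm.trans (hcell _ hK i hi.1))
      refine ⟨k + l, ?_⟩
      filter_upwards [hk, hl] with y h1 h2
      rw [h2, h1, add_assoc]
  obtain ⟨i₀⟩ : Nonempty I := by
    by_contra hI
    rw [not_nonempty_iff] at hI
    have hu := measure_univ (μ := μ)
    rw [← hcover] at hu
    simp at hu
  choose Jof hJof using fun i => (hJA i).exists
  have hmem : ∀ i, Jof i ∈ JA ∪ JB := fun i => Finset.mem_union_left _ (hJof i).1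
  choose k hk using fun i => hconst (Jof i₀) (hmem i₀) (Jof i) (hmem i)
  obtain ⟨α, hαm, ⟨A, hA⟩, hπform⟩ := exists_glued_potential (π := π) (μ := μ) (ν := ν) (c := c)
    (ε := ε) (b := b (Jof i₀)) hPm hcover hdisj (a := fun i x => a (Jof i) x + k i)
    (fun i => (ham _ (hmem i)).add_const _)
    (fun i => ⟨M (Jof i) + |k i|, fun x =>
      (abs_add_le _ _).trans (add_le_add_left (haM _ (hmem i) x) _)⟩)
    (fun i => by
      rw [hcell _ (hmem i) i (hJof i).2]
      refine withDensity_congr_ae ?_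
      filter_upwards [Measure.quasiMeasurePreserving_snd.ae (hk i)] with p hp
      simp only [gibbsDensity, hp]
      congr 3
      ring)
  have hopt := fun (σ : Measure (X × Y)) (hσ : IsCoupling μ ν σ) =>
    gibbs_coupling_optimal hcm hC hε hαm (hbm _ (hmem i₀)) hA (hbM _ (hmem i₀)) hπ hσ hπform
  have hKLπ : KL π (μ.prod ν) ≠ ⊤ :=
    hπform ▸ KL_gibbs_ne_top hcm hC hε hαm (hbm _ (hmem i₀)) hA (hbM _ (hmem i₀))
  refine ⟨⟨α, b (Jof i₀), hαm, hbm _ (hmem i₀), hπform⟩, fun σ hσ => ?_, fun σ hσ hmin => ?_⟩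
  · by_cases hKL : KL σ (μ.prod ν) = ⊤
    · rw [EOT_eq_top hε hKL]
      exact le_top
    · rw [EOT_eq_coe hKLπ, EOT_eq_coe hKL, EReal.coe_le_coe_iff]
      exact (hopt σ hσ hKL).1
  · have hle := hmin π hπ
    have hKL : KL σ (μ.prod ν) ≠ ⊤ := by
      intro hKL
      rw [EOT_eq_top hε hKL, EOT_eq_coe hKLπ, top_le_iff] at hle
      exact EReal.coe_ne_top _ hle
    rw [EOT_eq_coe hKLπ, EOT_eq_coe hKL, EReal.coe_le_coe_iff] at hle
    exact (hopt σ hσ hKL).2 hle
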